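/- Let δ ∈ GL_n(F) and suppose there exists g ∈ GL_n(E) with g⁻¹δg ∈ GL_n(O_E). Then there exists γ ∈ GL_n(E) with σ(γ)γ = δ and γ = c_{n−1}δ^{n−1} + ⋯ + c_1δ + c_0·1 for some c_0, …, c_{n−1} ∈ O_E; in particular γ is a Kottwitz element. -/

import Mathlib

/-!
STATEMENT 9 (Kottwitz, Lemma 8.8): If δ ∈ GL_n(F) is GL_n(E)-conjugate into
GL_n(O_E), then δ = σ(γ)γ for some γ which is an O_E-polynomial in δ; in
particular γ is a Kottwitz element.  E/F is an unramified quadratic extension of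
nonarchimedean local fields of characteristic zero (finite extensions of ℚ_p).
-/

open Matrix

/-- `g ∈ GL_n(O_E)`: all entries of `g` and of an inverse of `g` are integral. -/
def InGLnO (p : ℕ) [Fact p.Prime] {E : Type*} [Field E] [Algebra ℤ_[p] E]
    {n : ℕ} (g : Matrix (Fin n) (Fin n) E) : Prop :=
  (∀ i j, g i j ∈ integralClosure ℤ_[p] E) ∧
  ∃ h : Matrix (Fin n) (Fin n) E, (∀ i j, h i j ∈ integralClosure ℤ_[p] E) ∧
    g * h = 1 ∧ h * g = 1

/-- `γ` is a Kottwitz element. -/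
def IsKottwitz (p : ℕ) [Fact p.Prime] {F E : Type*} [Field F] [Field E] [Algebra F E]
    [Algebra ℤ_[p] E] (σ : E ≃ₐ[F] E) {n : ℕ} (γ : Matrix (Fin n) (Fin n) E) : Prop :=
  (∃ c : Fin n → E, (∀ k, c k ∈ integralClosure ℤ_[p] E) ∧
    γ = ∑ k : Fin n, c k • ((γ.map ⇑σ) * γ) ^ (k : ℕ)) ∨
  ¬ ∃ g : Matrix (Fin n) (Fin n) E, IsUnit g ∧ InGLnO p (g⁻¹ * ((γ.map ⇑σ) * γ) * g)


theorem adicComplete_aux (p : ℕ) [Fact p.Prime] (R : Type*) [CommRing R] [Algebra ℤ_[p] R]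
    [Module.Finite ℤ_[p] R] :
    IsAdicComplete ((IsLocalRing.maximalIdeal ℤ_[p]).map (algebraMap ℤ_[p] R)) R := by
  have h1 : IsHausdorff (IsLocalRing.maximalIdeal ℤ_[p]) R := inferInstance
  have h2 : IsPrecomplete (IsLocalRing.maximalIdeal ℤ_[p]) R := by
    rw [← AdicCompletion.of_surjective_iff]
    intro y
    obtain ⟨t, rfl⟩ := AdicCompletion.ofTensorProduct_surjective_of_finite
      (IsLocalRing.maximalIdeal ℤ_[p]) R y
    induction t using TensorProduct.induction_on with
    | zero => exact ⟨0, by simp⟩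
    | tmul r x =>
      obtain ⟨r, rfl⟩ := AdicCompletion.of_surjective (IsLocalRing.maximalIdeal ℤ_[p]) ℤ_[p] r
      refine ⟨r • x, ?_⟩
      rw [AdicCompletion.ofTensorProduct_tmul, map_smul]
      exact (algebraMap_smul (AdicCompletion (IsLocalRing.maximalIdeal ℤ_[p]) ℤ_[p]) r _).symm
    | add a b ha hb =>
      obtain ⟨a', ha⟩ := ha
      obtain ⟨b', hb⟩ := hb
      exact ⟨a' + b', by rw [map_add, map_add, ha, hb]⟩
  exact { toIsHausdorff := IsHausdorff.map_algebraMap_iff.mpr h1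
          toIsPrecomplete := IsPrecomplete.map_algebraMap_iff.mpr h2 }

theorem finite_quot_aux (p : ℕ) [Fact p.Prime] (R : Type*) [CommRing R] [Algebra ℤ_[p] R]
    [Module.Finite ℤ_[p] R] :
    Finite (R ⧸ ((IsLocalRing.maximalIdeal ℤ_[p]).map (algebraMap ℤ_[p] R))) := by
  have : Finite (ℤ_[p] ⧸ IsLocalRing.maximalIdeal ℤ_[p]) :=
    Finite.of_equiv (ZMod p) (PadicInt.residueField (p := p)).symm.toEquiv
  exact Module.finite_of_finite (ℤ_[p] ⧸ IsLocalRing.maximalIdeal ℤ_[p])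

theorem p_mem_jac (p : ℕ) [Fact p.Prime] (R : Type*) [CommRing R] [Algebra ℤ_[p] R]
    [Module.Finite ℤ_[p] R] : (IsLocalRing.maximalIdeal ℤ_[p]).map (algebraMap ℤ_[p] R) ≤
      Ideal.jacobson ⊥ := 
  have := adicComplete_aux p R
  IsAdicComplete.le_jacobson_bot _

theorem natp_mem_jac (p : ℕ) [Fact p.Prime] (R : Type*) [CommRing R] [Algebra ℤ_[p] R]
    [Module.Finite ℤ_[p] R] : (p : R) ∈ Ideal.jacobson (⊥ : Ideal R) := by
  apply p_mem_jac p R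
  have : (p : R) = algebraMap ℤ_[p] R p := by simp
  rw [this]
  apply Ideal.mem_map_of_mem
  rw [PadicInt.maximalIdeal_eq_span_p]
  exact Ideal.mem_span_singleton_self _

theorem finite_quot_jac (p : ℕ) [Fact p.Prime] (R : Type*) [CommRing R] [Algebra ℤ_[p] R]
    [Module.Finite ℤ_[p] R] : Finite (R ⧸ Ideal.jacobson (⊥ : Ideal R)) := by
  have := finite_quot_aux p R
  exact Finite.of_surjective _ (Ideal.Quotient.factor_surjective (p_mem_jac p R))

theorem jac_pow_le (p : ℕ) [Fact p.Prime] (R : Type*) [CommRing R] [Algebra ℤ_[p] R]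
    [Module.Finite ℤ_[p] R] : ∃ N : ℕ, 1 ≤ N ∧ Ideal.jacobson (⊥ : Ideal R) ^ N ≤
      (IsLocalRing.maximalIdeal ℤ_[p]).map (algebraMap ℤ_[p] R) := by
  have := finite_quot_aux p R
  set I := (IsLocalRing.maximalIdeal ℤ_[p]).map (algebraMap ℤ_[p] R) with hI
  obtain ⟨N, hN⟩ := IsArtinianRing.isNilpotent_jacobson_bot (R := R ⧸ I)
  refine ⟨N + 1, by omega, ?_⟩
  have h1 : (Ideal.jacobson (⊥ : Ideal R)).map (Ideal.Quotient.mk I) ≤ Ideal.jacobson ⊥ := by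
    rw [Ideal.map_le_iff_le_comap, Ideal.comap_jacobson_of_surjective Ideal.Quotient.mk_surjective]
    exact Ideal.jacobson_mono bot_le
  have h2 := Ideal.pow_right_mono h1 (N+1)
  rw [pow_succ (Ideal.jacobson ⊥), hN, ← Ideal.map_pow] at h2
  have h3 := Ideal.map_le_iff_le_comap.mp (h2.trans (by simp : _ ≤ (⊥ : Ideal (R ⧸ I))))
  rwa [← RingHom.ker_eq_comap_bot, Ideal.mk_ker] at h3

theorem isUnit_of_sub_jac {R : Type*} [CommRing R] {a b : R} (ha : IsUnit a)
    (h : b - a ∈ Ideal.jacobson (⊥ : Ideal R)) : IsUnit b := by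
  have := isLocalHom_of_le_jacobson_bot (Ideal.jacobson (⊥ : Ideal R)) le_rfl
  apply this.map_nonunit
  rw [Ideal.Quotient.eq.mpr h]
  exact ha.map _

/-- Hensel's lemma for quadratic polynomials, relative to the Jacobson radical. -/
theorem hensel_quad (p : ℕ) [Fact p.Prime] (R : Type*) [CommRing R] [Algebra ℤ_[p] R]
    [Module.Finite ℤ_[p] R] (a e : R) (ha : IsUnit a) (he : e ∈ Ideal.jacobson (⊥ : Ideal R)) :
    ∃ t ∈ Ideal.jacobson (⊥ : Ideal R), t ^ 2 + a * t + e = 0 := by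
  have hstep : ∀ N : ℕ, ∃ t ∈ Ideal.jacobson (⊥ : Ideal R),
      t ^ 2 + a * t + e ∈ Ideal.jacobson (⊥ : Ideal R) ^ (N + 1) := by
    intro N
    induction N with
    | zero => exact ⟨0, zero_mem _, by simpa using he⟩
    | succ N ih =>
      obtain ⟨t, ht, h⟩ := ih
      have hu : IsUnit (2 * t + a) :=
        isUnit_of_sub_jac ha (by simpa using Ideal.mul_mem_left _ 2 ht)
      obtain ⟨u, hu⟩ := hu
      set f := t ^ 2 + a * t + e with hf
      have hd : f * (↑u⁻¹ : R) ∈ Ideal.jacobson (⊥ : Ideal R) ^ (N + 1) :=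
        Ideal.mul_mem_right _ _ h
      have hd1 : f * (↑u⁻¹ : R) ∈ Ideal.jacobson (⊥ : Ideal R) :=
        Ideal.pow_le_self (by omega) hd
      refine ⟨t - f * (↑u⁻¹ : R), sub_mem ht hd1, ?_⟩
      have : (t - f * (↑u⁻¹ : R)) ^ 2 + a * (t - f * (↑u⁻¹ : R)) + e
          = (f * (↑u⁻¹ : R)) * (f * (↑u⁻¹ : R)) := by
        have h1 : (2 * t + a) * (↑u⁻¹ : R) = 1 := by rw [← hu]; simp
        linear_combination (-f) * h1 - hf
      rw [this, pow_succ]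
      exact Ideal.mul_mem_mul hd hd1
  obtain ⟨N, hN, hle⟩ := jac_pow_le p R
  obtain ⟨t, ht, h⟩ := hstep (N - 1)
  rw [Nat.sub_add_cancel hN] at h
  have := adicComplete_aux p R
  set I := (IsLocalRing.maximalIdeal ℤ_[p]).map (algebraMap ℤ_[p] R) with hI
  obtain ⟨s, hs, hst⟩ := HenselianRing.is_henselian (I := I)
    (Polynomial.X ^ 2 + Polynomial.C a * Polynomial.X + Polynomial.C e)
    (by monicity!) t (by simpa using hle h) (by
      apply IsUnit.map
      have : Polynomial.eval t (Polynomial.derivative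
        (Polynomial.X ^ 2 + Polynomial.C a * Polynomial.X + Polynomial.C e)) = 2 * t + a := by
        simp
        ring
      rw [this]
      exact isUnit_of_sub_jac ha (by simpa using Ideal.mul_mem_left _ 2 ht))
  refine ⟨s, ?_, by simpa [Polynomial.IsRoot] using hs⟩
  have := p_mem_jac p R hst
  simpa using add_mem this ht

theorem reduced_quot_jac (R : Type*) [CommRing R] : IsReduced (R ⧸ Ideal.jacobson (⊥ : Ideal R)) := by
  rw [← Ideal.isRadical_iff_quotient_reduced]
  exact Ideal.isRadical_jacobson _

/-- A finite `ℤ_p`-algebra which is a domain is local. -/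
theorem isLocalRing_aux (p : ℕ) [Fact p.Prime] (R : Type*) [CommRing R] [IsDomain R]
    [Algebra ℤ_[p] R] [Module.Finite ℤ_[p] R] : IsLocalRing R := by
  have := finite_quot_jac p R
  have := reduced_quot_jac R
  refine IsLocalRing.of_unique_max_ideal ?_
  obtain ⟨M, hM⟩ := Ideal.exists_maximal R
  refine ⟨M, hM, fun M' hM' => ?_⟩
  by_contra hne
  obtain ⟨x, hx', hx⟩ : ∃ x ∈ M', x ∉ M := by
    by_contra! h
    exact hne (hM'.eq_of_le hM.ne_top h)
  -- an idempotent in the quotient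
  set J := Ideal.jacobson (⊥ : Ideal R) with hJ
  have hJM : ∀ M : Ideal R, M.IsMaximal → J ≤ M := fun M hM => by
    rw [hJ]; exact sInf_le ⟨bot_le, hM⟩
  obtain ⟨k, hk, hid⟩ : ∃ k : ℕ, 1 ≤ k ∧ x ^ k * x ^ k - x ^ k ∈ J := by
    obtain ⟨i, j, hij, hpow⟩ := Finite.exists_ne_map_eq_of_infinite
      (fun k : ℕ => (Ideal.Quotient.mk J x) ^ k)
    wlog hlt : i < j generalizing i j
    · exact this j i hij.symm hpow.symm (by omega)
    obtain ⟨d, rfl⟩ := Nat.exists_eq_add_of_lt hlt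
    have hpow : (Ideal.Quotient.mk J x) ^ i = (Ideal.Quotient.mk J x) ^ (i + d + 1) := hpow
    have hgen : ∀ m n : ℕ, (Ideal.Quotient.mk J x) ^ (i + n)
        = (Ideal.Quotient.mk J x) ^ (i + n + (d + 1) * m) := by
      intro m n
      induction m with
      | zero => simp
      | succ m ih =>
        rw [ih, show i + n + (d + 1) * m = i + (n + (d + 1) * m) by ring, pow_add, hpow, ← pow_add]
        congr 1; ring
    refine ⟨(d + 1) * (i + 1), by nlinarith, ?_⟩
    rw [← Ideal.Quotient.eq]
    simp only [map_mul, map_pow]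
    have := hgen (i + 1) (d * (i + 1) + 1)
    rw [show i + (d * (i + 1) + 1) = (d + 1) * (i + 1) by ring] at this
    rw [← pow_add, ← this]
  obtain ⟨t, ht, hroot⟩ := hensel_quad p R (2 * x ^ k - 1) (x ^ k * x ^ k - x ^ k) (by
    rw [← isUnit_pow_iff (two_ne_zero)]
    refine isUnit_of_sub_jac isUnit_one ?_
    have : (2 * x ^ k - 1) ^ 2 - 1 = 4 * (x ^ k * x ^ k - x ^ k) := by ring
    rw [this]
    exact Ideal.mul_mem_left _ _ hid) hid
  have h0 : (x ^ k + t) * (x ^ k + t - 1) = 0 := by linear_combination hroot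
  have hxk : x ^ k ∈ M' := Ideal.pow_mem_of_mem _ hx' _ hk
  rcases mul_eq_zero.mp h0 with h | h
  · have : x ^ k ∈ M := by
      have := neg_mem (hJM M hM ht)
      rwa [← eq_neg_of_add_eq_zero_left h] at this
    exact hx (hM.isPrime.mem_of_pow_mem _ this)
  · apply hM'.ne_top
    rw [Ideal.eq_top_iff_one, ← sub_eq_zero.mp h]
    exact add_mem hxk (hJM M' hM' ht)

theorem exists_sq_add_sq (p : ℕ) [Fact p.Prime] (hp : p ≠ 2) (R : Type*) [CommRing R] [Algebra ℤ_[p] R]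
    [Module.Finite ℤ_[p] R] (u d : R) (hu : IsUnit u) (hd : IsUnit d) :
    ∃ x y : R, x ^ 2 - u * y ^ 2 = d := by
  have := finite_quot_jac p R
  have := reduced_quot_jac R
  set J := Ideal.jacobson (⊥ : Ideal R) with hJ
  have h2J : IsUnit (2 : R) := by
    have hc : Nat.Coprime p 2 := by
      rw [Nat.coprime_primes (Fact.out) Nat.prime_two]; exact hp
    obtain ⟨a, b, hab⟩ := Nat.isCoprime_iff_coprime.mpr hc
    have h1 : (a : R) * p + b * 2 = 1 := by exact_mod_cast congrArg (Int.cast (R := R)) hab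
    have : IsUnit ((b : R) * 2) := by
      refine isUnit_of_sub_jac isUnit_one ?_
      have : (b : R) * 2 - 1 = - (a * p) := by linear_combination h1
      rw [this]
      exact neg_mem (Ideal.mul_mem_left _ _ (natp_mem_jac p R))
    exact isUnit_of_mul_isUnit_right this
  have key : ∃ x y : R ⧸ J, x ^ 2 - (Ideal.Quotient.mk J u) * y ^ 2 = Ideal.Quotient.mk J d := by
    let e := IsArtinianRing.equivPi (R ⧸ J)
    have hk : ∀ m : MaximalSpectrum (R ⧸ J), ∃ x y : (R ⧸ J) ⧸ m.asIdeal,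
        x ^ 2 - e (Ideal.Quotient.mk J u) m * y ^ 2 = e (Ideal.Quotient.mk J d) m := by
      intro m
      let _ := Ideal.Quotient.field m.asIdeal
      have : Finite ((R ⧸ J) ⧸ m.asIdeal) :=
        Finite.of_surjective _ (Ideal.Quotient.mk_surjective (I := m.asIdeal))
      have : Fintype ((R ⧸ J) ⧸ m.asIdeal) := Fintype.ofFinite _
      set u' := e (Ideal.Quotient.mk J u) m with hu'
      have hu0 : u' ≠ 0 := by
        have : IsUnit u' := ((hu.map (Ideal.Quotient.mk J)).map e).map (Pi.evalRingHom _ m)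
        exact this.ne_zero
      set d' := e (Ideal.Quotient.mk J d) m with hd'
      have h2 : (2 : (R ⧸ J) ⧸ m.asIdeal) ≠ 0 := by
        have := ((h2J.map (Ideal.Quotient.mk J)).map (Ideal.Quotient.mk m.asIdeal)).ne_zero
        rwa [map_ofNat, map_ofNat] at this
      obtain ⟨x, y, hxy⟩ := FiniteField.exists_root_sum_quadratic
        (f := (Polynomial.X ^ 2 - Polynomial.C d' : Polynomial ((R ⧸ J) ⧸ m.asIdeal)))
        (g := Polynomial.C (-u') * Polynomial.X ^ 2)
        (Polynomial.degree_X_pow_sub_C (by norm_num) _)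
        (by rw [Polynomial.degree_C_mul_X_pow _ (neg_ne_zero.mpr hu0)]; rfl)
        (by
          apply FiniteField.odd_card_of_char_ne_two
          intro hc
          apply h2
          have := ringChar.Nat.cast_ringChar (R := (R ⧸ J) ⧸ m.asIdeal)
          rw [hc] at this
          exact_mod_cast this)
      refine ⟨x, y, ?_⟩
      simp at hxy
      linear_combination hxy
    choose x y hxy using hk
    refine ⟨e.symm x, e.symm y, e.injective ?_⟩
    ext m
    rw [← hxy m]
    simp
  obtain ⟨x, y, hxy⟩ := key
  obtain ⟨x, rfl⟩ := Ideal.Quotient.mk_surjective x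
  obtain ⟨y, rfl⟩ := Ideal.Quotient.mk_surjective y
  have hmem : (x ^ 2 - u * y ^ 2) - d ∈ J := by
    rw [← Ideal.Quotient.eq]; simpa using hxy
  obtain ⟨w, hw⟩ := isUnit_of_sub_jac hd hmem
  obtain ⟨t, ht, hroot⟩ := hensel_quad p R 2 (1 - d * (↑w⁻¹ : R)) h2J (by
    have : (1 - d * (↑w⁻¹ : R)) = (w - d) * (↑w⁻¹ : R) := by rw [sub_mul]; simp
    rw [this, hw]
    exact Ideal.mul_mem_right _ _ hmem)
  refine ⟨x * (1 + t), y * (1 + t), ?_⟩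
  have h1 : (w : R) * (↑w⁻¹ : R) = 1 := by simp
  linear_combination (x ^ 2 - u * y ^ 2) * hroot - d * (↑w⁻¹ : R) * hw + d * h1

theorem exists_sq_jac [Fact (Nat.Prime 2)] (R : Type*) [CommRing R] [Algebra ℤ_[2] R]
    [Module.Finite ℤ_[2] R] (d : R) :
    ∃ x : R, x ^ 2 - d ∈ Ideal.jacobson (⊥ : Ideal R) := by
  have := finite_quot_jac 2 R
  have := reduced_quot_jac R
  set J := Ideal.jacobson (⊥ : Ideal R) with hJ
  have h2 : (2 : R ⧸ J) = 0 := by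
    have : Ideal.Quotient.mk J (2 : R) = 0 :=
      Ideal.Quotient.eq_zero_iff_mem.mpr (by exact_mod_cast natp_mem_jac 2 R)
    rwa [map_ofNat] at this
  have hinj : Function.Injective (fun x : R ⧸ J => x ^ 2) := by
    intro x y hxy
    have hxy : x ^ 2 = y ^ 2 := hxy
    have : (x - y) ^ 2 = 0 := by linear_combination hxy + (y ^ 2 - x * y) * h2
    exact sub_eq_zero.mp (pow_eq_zero_iff (two_ne_zero) |>.mp this)
  obtain ⟨x, hx⟩ := Finite.surjective_of_injective hinj (Ideal.Quotient.mk J d)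
  obtain ⟨x, rfl⟩ := Ideal.Quotient.mk_surjective x
  refine ⟨x, ?_⟩
  rw [← Ideal.Quotient.eq]
  simpa using hx

theorem exists_norm_two [Fact (Nat.Prime 2)] (R : Type*) [CommRing R] [Algebra ℤ_[2] R]
    [Module.Finite ℤ_[2] R] (a b d : R) (ha : IsUnit a) (hb : IsUnit b) (hd : IsUnit d) :
    ∃ x y : R, x ^ 2 + a * x * y + b * y ^ 2 = d := by
  obtain ⟨x, hx⟩ := exists_sq_jac R d
  obtain ⟨w, hw⟩ := isUnit_of_sub_jac hd hx
  obtain ⟨b, rfl⟩ := hb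
  obtain ⟨t, ht, hroot⟩ := hensel_quad 2 R (a * (↑b⁻¹ : R)) ((↑b⁻¹ : R) * (1 - d * (↑w⁻¹ : R)))
    (ha.mul (Units.isUnit _)) (by
    have : (1 - d * (↑w⁻¹ : R)) = (w - d) * (↑w⁻¹ : R) := by rw [sub_mul]; simp
    rw [this, hw]
    exact Ideal.mul_mem_left _ _ (Ideal.mul_mem_right _ _ hx))
  refine ⟨x, x * t, ?_⟩
  have h1 : (w : R) * (↑w⁻¹ : R) = 1 := by simp
  have h2 : (b : R) * (↑b⁻¹ : R) = 1 := by simp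
  have hroot' : b * t ^ 2 + a * t + (1 - d * (↑w⁻¹ : R)) = 0 := by
    linear_combination b * hroot - (a * t + (1 - d * (↑w⁻¹ : R))) * h2
  linear_combination x ^ 2 * hroot' - d * (↑w⁻¹ : R) * hw + d * h1

section localfield

variable (p : ℕ) [Fact p.Prime] {E : Type*} [Field E] [Algebra ℚ_[p] E]
    [FiniteDimensional ℚ_[p] E] [Algebra ℤ_[p] E] [IsScalarTower ℤ_[p] ℚ_[p] E]

theorem finite_O : Module.Finite ℤ_[p] (integralClosure ℤ_[p] E) :=
  IsIntegralClosure.finite ℤ_[p] ℚ_[p] E _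

theorem dvr_O (π : integralClosure ℤ_[p] E) (hπ : Irreducible π) :
    IsDiscreteValuationRing (integralClosure ℤ_[p] E) := by
  have := finite_O p (E := E)
  have := isLocalRing_aux p (integralClosure ℤ_[p] E)
  have h1 : IsDedekindDomain (integralClosure ℤ_[p] E) :=
    integralClosure.isDedekindDomain ℤ_[p] ℚ_[p] E
  have hnf : ¬ IsField (integralClosure ℤ_[p] E) := by
    intro hf
    obtain ⟨y, hy⟩ := hf.mul_inv_cancel hπ.ne_zero
    exact hπ.not_isUnit (IsUnit.of_mul_eq_one y hy)
  exact ((IsDiscreteValuationRing.TFAE _ hnf).out 2 0).mp h1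

theorem exists_integral_mul (v : E) : ∃ y : ℤ_[p], y ≠ 0 ∧ IsIntegral ℤ_[p] (y • v) := by
  have h : IsAlgebraic ℤ_[p] v :=
    (IsFractionRing.isAlgebraic_iff ℤ_[p] ℚ_[p] E).mpr (Algebra.IsAlgebraic.isAlgebraic v)
  exact h.exists_integral_multiple

end localfield

theorem exists_gen
    (p : ℕ) [Fact p.Prime] {F E : Type*} [Field F] [Field E]
    [Algebra ℚ_[p] F] [Algebra ℚ_[p] E] [Algebra F E] [IsScalarTower ℚ_[p] F E]
    [FiniteDimensional ℚ_[p] F] [FiniteDimensional ℚ_[p] E]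
    [Algebra ℤ_[p] F] [Algebra ℤ_[p] E]
    [IsScalarTower ℤ_[p] ℚ_[p] F] [IsScalarTower ℤ_[p] ℚ_[p] E] [IsScalarTower ℤ_[p] F E]
    (σ : E ≃ₐ[F] E)
    (hσ2 : ∀ x : E, σ (σ x) = x)
    (hfix : ∀ x : E, σ x = x ↔ x ∈ Set.range (algebraMap F E))
    (hdeg : Module.finrank F E = 2)
    (hunr : ∃ (π : F) (hπ : π ∈ integralClosure ℤ_[p] F)
      (hπE : algebraMap F E π ∈ integralClosure ℤ_[p] E),
      Irreducible (⟨π, hπ⟩ : integralClosure ℤ_[p] F) ∧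
      Irreducible (⟨algebraMap F E π, hπE⟩ : integralClosure ℤ_[p] E)) :
    ∃ (c : integralClosure ℤ_[p] E) (a b : integralClosure ℤ_[p] F),
      (c : E) + σ c = algebraMap F E a ∧ (c : E) * σ c = algebraMap F E b ∧
      IsUnit b ∧ (p = 2 → IsUnit a) ∧ (p ≠ 2 → a = 0) := by
  obtain ⟨π, hπ, hπE, hirr, hirrE⟩ := hunr
  have := finite_O p (E := E)
  have := finite_O p (E := F)
  have := dvr_O p _ hirr
  have := dvr_O p _ hirrE
  have hinj : Function.Injective (algebraMap F E) := (algebraMap F E).injective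
  have hint : ∀ x : F, IsIntegral ℤ_[p] (algebraMap F E x) ↔ IsIntegral ℤ_[p] x := fun x =>
    isIntegral_algebraMap_iff hinj
  have hσint : ∀ x : E, IsIntegral ℤ_[p] x → IsIntegral ℤ_[p] (σ x) := fun x hx =>
    hx.map (σ.toAlgHom.restrictScalars ℤ_[p])
  have hσy : ∀ (y : ℤ_[p]) (x : E), σ (y • x) = y • σ x := fun y x =>
    map_smul (σ.toAlgHom.restrictScalars ℤ_[p]) y x
  -- an anti-invariant integral element
  obtain ⟨w, hw0, hw⟩ : ∃ w : integralClosure ℤ_[p] E, w ≠ 0 ∧ σ w = -w := by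
    obtain ⟨x, hx⟩ : ∃ x : E, σ x ≠ x := by
      by_contra! h
      have hs : Function.Surjective (algebraMap F E) := fun x => (hfix x).mp (h x)
      have : Module.finrank F E = 1 := by
        rw [← Module.finrank_self F]
        exact (LinearEquiv.ofBijective (Algebra.linearMap F E) ⟨hinj, hs⟩).finrank_eq.symm
      omega
    obtain ⟨y, hy, hyi⟩ := exists_integral_mul p (x - σ x)
    refine ⟨⟨y • (x - σ x), hyi⟩, ?_, ?_⟩
    · intro h
      have h : y • (x - σ x) = 0 := congrArg Subtype.val h
      rw [← algebraMap_smul ℚ_[p] y (x - σ x)] at h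
      rcases smul_eq_zero.mp h with h | h
      · exact hy (by simpa using h)
      · exact hx (sub_eq_zero.mp h).symm
    · change σ (y • (x - σ x)) = -(y • (x - σ x))
      rw [hσy, map_sub, hσ2, ← smul_neg, neg_sub]
  -- traces and norms
  have htr : ∀ c : integralClosure ℤ_[p] E, ∃ a : integralClosure ℤ_[p] F,
      (c : E) + σ c = algebraMap F E a := by
    intro c
    obtain ⟨a, ha⟩ := (hfix ((c : E) + σ c)).mp (by rw [map_add, hσ2, add_comm])
    refine ⟨⟨a, ?_⟩, ha.symm⟩
    rw [mem_integralClosure_iff, ← hint, ha]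
    exact c.2.add (hσint _ c.2)
  have hnm : ∀ c : integralClosure ℤ_[p] E, ∃ a : integralClosure ℤ_[p] F,
      (c : E) * σ c = algebraMap F E a := by
    intro c
    obtain ⟨a, ha⟩ := (hfix ((c : E) * σ c)).mp (by rw [map_mul, hσ2, mul_comm])
    refine ⟨⟨a, ?_⟩, ha.symm⟩
    rw [mem_integralClosure_iff, ← hint, ha]
    exact c.2.mul (hσint _ c.2)
  have hnmu : ∀ c : integralClosure ℤ_[p] E, IsUnit c → ∃ a : integralClosure ℤ_[p] F,
      (c : E) * σ c = algebraMap F E a ∧ IsUnit a := by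
    rintro c ⟨u, rfl⟩
    obtain ⟨a, ha⟩ := hnm u
    obtain ⟨b, hb⟩ := hnm (↑u⁻¹ : integralClosure ℤ_[p] E)
    refine ⟨a, ha, IsUnit.of_mul_eq_one b ?_⟩
    apply Subtype.ext
    apply hinj
    have h1 : ((u : integralClosure ℤ_[p] E) : E) * ((↑u⁻¹ : integralClosure ℤ_[p] E) : E) = 1 := by
      exact_mod_cast congrArg Subtype.val (u.mul_inv)
    have h2 := congrArg σ h1
    rw [map_mul, map_one] at h2
    have : algebraMap F E (a * b : integralClosure ℤ_[p] F) = 1 := by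
      rw [MulMemClass.coe_mul, map_mul, ← ha, ← hb]
      linear_combination h2 + h1 * σ ((u : integralClosure ℤ_[p] E) : E)
        * σ ((↑u⁻¹ : integralClosure ℤ_[p] E) : E)
    simpa using this
  by_cases hp : p = 2
  · subst hp
    let j : integralClosure ℤ_[2] F →ₐ[ℤ_[2]] integralClosure ℤ_[2] E :=
      (IsScalarTower.toAlgHom ℤ_[2] F E).mapIntegralClosure
    have hj : ∀ s : integralClosure ℤ_[2] F, ((j s : integralClosure ℤ_[2] E) : E)
      = algebraMap F E s := fun s => rfl
    set ϖ : integralClosure ℤ_[2] F := ⟨π, hπ⟩ with hϖ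
    have hjπ : j ϖ = ⟨algebraMap F E π, hπE⟩ := rfl
    rw [← hjπ] at hirrE
    have hmax := hirr.maximalIdeal_eq
    have hmaxE := hirrE.maximalIdeal_eq
    have hjm : ∀ s ∈ IsLocalRing.maximalIdeal (integralClosure ℤ_[2] F),
        j s ∈ IsLocalRing.maximalIdeal (integralClosure ℤ_[2] E) := by
      intro s hs
      rw [hmax, Ideal.mem_span_singleton] at hs
      rw [hmaxE, Ideal.mem_span_singleton]
      exact map_dvd j hs
    obtain ⟨x, hx⟩ : ∃ x : integralClosure ℤ_[2] E, ∀ s : integralClosure ℤ_[2] F,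
        x - j s ∉ IsLocalRing.maximalIdeal (integralClosure ℤ_[2] E) := by
      by_contra! h
      let _ : Algebra (integralClosure ℤ_[2] F) (integralClosure ℤ_[2] E) := j.toRingHom.toAlgebra
      have : IsScalarTower ℤ_[2] (integralClosure ℤ_[2] F) (integralClosure ℤ_[2] E) :=
        IsScalarTower.of_algebraMap_eq fun r => (j.commutes r).symm
      have : Module.Finite (integralClosure ℤ_[2] F) (integralClosure ℤ_[2] E) :=
        Module.Finite.of_restrictScalars_finite ℤ_[2] _ _
      have hN := Submodule.le_of_le_smul_of_le_jacobson_bot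
        (I := IsLocalRing.maximalIdeal (integralClosure ℤ_[2] F))
        (N := LinearMap.range (Algebra.linearMap (integralClosure ℤ_[2] F)
          (integralClosure ℤ_[2] E))) (N' := ⊤) Module.Finite.fg_top
        (IsLocalRing.maximalIdeal_le_jacobson _) (by
          intro x _
          obtain ⟨s, hs⟩ := h x
          rw [hmaxE, Ideal.mem_span_singleton] at hs
          obtain ⟨r, hr⟩ := hs
          rw [sub_eq_iff_eq_add'.mp hr]
          refine Submodule.add_mem_sup ⟨s, rfl⟩ ?_
          exact Submodule.smul_mem_smul (r := ϖ) (n := r)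
            (hmax ▸ Ideal.mem_span_singleton_self _) trivial)
      obtain ⟨s, hs⟩ := hN (show w ∈ ⊤ from trivial)
      have hs : (w : E) = algebraMap F E s := by rw [← hj]; exact congrArg Subtype.val hs.symm
      have h1 := (hfix (w : E)).mpr ⟨_, hs.symm⟩
      rw [hw] at h1
      have : CharZero E := charZero_of_injective_algebraMap (algebraMap ℚ_[2] E).injective
      apply hw0
      apply Subtype.ext
      exact neg_eq_self.mp h1
    have hxu : IsUnit x := by
      have := hx 0
      rw [map_zero, sub_zero] at this
      simpa using this
    obtain ⟨a, ha⟩ := htr x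
    obtain ⟨b, hb, hbu⟩ := hnmu x hxu
    refine ⟨x, a, b, ha, hb, hbu, fun _ => ?_, fun h => absurd rfl h⟩
    by_contra hau
    obtain ⟨s, hs⟩ := exists_sq_jac (integralClosure ℤ_[2] F) b
    apply hx s
    have hJ : Ideal.jacobson (⊥ : Ideal (integralClosure ℤ_[2] F))
      = IsLocalRing.maximalIdeal _ := IsLocalRing.jacobson_eq_maximalIdeal _ bot_ne_top
    have h2 := natp_mem_jac 2 (integralClosure ℤ_[2] F)
    rw [hJ] at hs h2
    have hsq : (x - j s) ^ 2 = j a * x - j ((2 : ℕ) : integralClosure ℤ_[2] F) * (j s * x)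
        + j (s ^ 2 - b) := by
      apply Subtype.ext
      have e1 : algebraMap F E ((s ^ 2 - b : integralClosure ℤ_[2] F) : F)
          = algebraMap F E s ^ 2 - x * σ x := by
        rw [hb, ← map_pow, ← map_sub]
        rfl
      have e2 : algebraMap F E (((2 : ℕ) : integralClosure ℤ_[2] F) : F) = 2 := by
        change algebraMap F E ((algebraMap (integralClosure ℤ_[2] F) F) ((2 : ℕ) : _)) = 2
        rw [map_natCast, map_natCast]
        norm_num
      change ((x : E) - algebraMap F E s) ^ 2 = algebraMap F E a * x
        - algebraMap F E (((2 : ℕ) : integralClosure ℤ_[2] F) : F) * (algebraMap F E s * x)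
        + algebraMap F E ((s ^ 2 - b : integralClosure ℤ_[2] F) : F)
      rw [← ha, e1, e2]
      ring
    have : (x - j s) ^ 2 ∈ IsLocalRing.maximalIdeal (integralClosure ℤ_[2] E) := by
      rw [hsq]
      refine add_mem (sub_mem (Ideal.mul_mem_right _ _ (hjm _ ?_))
        (Ideal.mul_mem_right _ _ (hjm _ h2))) (hjm _ hs)
      simpa using hau
    exact (IsLocalRing.maximalIdeal.isMaximal _).isPrime.mem_of_pow_mem _ this
  · obtain ⟨n, u, hu⟩ := IsDiscreteValuationRing.eq_unit_mul_pow_irreducible hw0 hirrE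
    obtain ⟨b, hb, hbu⟩ := hnmu u u.isUnit
    have huE : (w : E) = (u : integralClosure ℤ_[p] E) * algebraMap F E π ^ n := by
      rw [hu]; simp
    have hπ0 : algebraMap F E π ≠ 0 := fun h => hirrE.ne_zero (Subtype.ext h)
    refine ⟨u, 0, b, ?_, hb, hbu, fun h => absurd h hp, fun _ => rfl⟩
    have h1 := hw
    rw [huE, map_mul, map_pow, AlgEquiv.commutes] at h1
    have h2 : ((u : integralClosure ℤ_[p] E) + σ (u : integralClosure ℤ_[p] E) : E)
      * algebraMap F E π ^ n = 0 := by linear_combination h1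
    simpa using (mul_eq_zero.mp h2).resolve_right (pow_ne_zero _ hπ0)

theorem exists_repr
    (p : ℕ) [Fact p.Prime] {F : Type*} [Field F] [Algebra ℚ_[p] F]
    [FiniteDimensional ℚ_[p] F] [Algebra ℤ_[p] F] [IsScalarTower ℤ_[p] ℚ_[p] F]
    (f : Polynomial (integralClosure ℤ_[p] F)) (hf : f.Monic) (hf0 : IsUnit (f.coeff 0))
    (a b : integralClosure ℤ_[p] F)
    (hb : IsUnit b) (ha2 : p = 2 → IsUnit a) (ha : p ≠ 2 → a = 0) :
    ∃ P Q : Polynomial (integralClosure ℤ_[p] F), P.degree < f.degree ∧ Q.degree < f.degree ∧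
      f ∣ P ^ 2 + Polynomial.C a * P * Q + Polynomial.C b * Q ^ 2 - Polynomial.X := by
  have := finite_O p (E := F)
  have : Module.Finite (integralClosure ℤ_[p] F) (AdjoinRoot f) := hf.finite_adjoinRoot
  have : Module.Finite ℤ_[p] (AdjoinRoot f) := Module.Finite.trans (integralClosure ℤ_[p] F) _
  have hroot : IsUnit (AdjoinRoot.root f) := by
    have h1 : AdjoinRoot.root f * AdjoinRoot.mk f f.divX = - AdjoinRoot.of f (f.coeff 0) := by
      have h2 := congrArg (AdjoinRoot.mk f) f.X_mul_divX_add
      rw [map_add, map_mul, AdjoinRoot.mk_self, AdjoinRoot.mk_X, AdjoinRoot.mk_C] at h2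
      exact eq_neg_of_add_eq_zero_left h2
    have h3 : IsUnit (AdjoinRoot.root f * AdjoinRoot.mk f f.divX) := by
      rw [h1]
      exact (hf0.map (AdjoinRoot.of f)).neg
    exact isUnit_of_mul_isUnit_left h3
  have key : ∃ x y : AdjoinRoot f, x ^ 2 + AdjoinRoot.of f a * x * y + AdjoinRoot.of f b * y ^ 2
      = AdjoinRoot.root f := by
    by_cases hp : p = 2
    · subst hp
      exact exists_norm_two (AdjoinRoot f) _ _ _ ((ha2 rfl).map _) (hb.map _) hroot
    · obtain ⟨x, y, hxy⟩ := exists_sq_add_sq p hp (AdjoinRoot f) (-(AdjoinRoot.of f b)) _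
        (hb.map (AdjoinRoot.of f)).neg hroot
      refine ⟨x, y, ?_⟩
      rw [ha hp, map_zero]
      linear_combination hxy
  obtain ⟨x, y, hxy⟩ := key
  obtain ⟨P, rfl⟩ := AdjoinRoot.mk_surjective x
  obtain ⟨Q, rfl⟩ := AdjoinRoot.mk_surjective y
  have hmod : ∀ P : Polynomial (integralClosure ℤ_[p] F),
      AdjoinRoot.mk f (P %ₘ f) = AdjoinRoot.mk f P := by
    intro P
    rw [AdjoinRoot.mk_eq_mk]
    exact ⟨-(P /ₘ f), by linear_combination Polynomial.modByMonic_add_div P f⟩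
  refine ⟨P %ₘ f, Q %ₘ f, Polynomial.degree_modByMonic_lt _ hf,
    Polynomial.degree_modByMonic_lt _ hf, ?_⟩
  rw [← AdjoinRoot.mk_eq_mk]
  simp only [map_add, map_mul, map_pow, hmod, AdjoinRoot.mk_C, AdjoinRoot.mk_X]
  exact hxy

set_option maxHeartbeats 1000000 in
theorem kottwitz_lemma_8_8
    (p : ℕ) [Fact p.Prime] {F E : Type*} [Field F] [Field E]
    [Algebra ℚ_[p] F] [Algebra ℚ_[p] E] [Algebra F E] [IsScalarTower ℚ_[p] F E]
    [FiniteDimensional ℚ_[p] F] [FiniteDimensional ℚ_[p] E]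
    [Algebra ℤ_[p] F] [Algebra ℤ_[p] E]
    [IsScalarTower ℤ_[p] ℚ_[p] F] [IsScalarTower ℤ_[p] ℚ_[p] E]
    (σ : E ≃ₐ[F] E)
    (hσ2 : ∀ x : E, σ (σ x) = x)
    (hfix : ∀ x : E, σ x = x ↔ x ∈ Set.range (algebraMap F E))
    (hdeg : Module.finrank F E = 2)
    -- unramifiedness: some uniformizer of O_F remains irreducible in O_E
    (hunr : ∃ (π : F) (hπ : π ∈ integralClosure ℤ_[p] F)
      (hπE : algebraMap F E π ∈ integralClosure ℤ_[p] E),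
      Irreducible (⟨π, hπ⟩ : integralClosure ℤ_[p] F) ∧
      Irreducible (⟨algebraMap F E π, hπE⟩ : integralClosure ℤ_[p] E))
    (n : ℕ) (hn : 1 ≤ n)
    (δ : Matrix (Fin n) (Fin n) F) (hδ : IsUnit δ)
    (hconj : ∃ g : Matrix (Fin n) (Fin n) E, IsUnit g ∧
      InGLnO p (g⁻¹ * δ.map (algebraMap F E) * g)) :
    ∃ γ : Matrix (Fin n) (Fin n) E, IsUnit γ ∧
      (γ.map ⇑σ) * γ = δ.map (algebraMap F E) ∧
      (∃ c : Fin n → E, (∀ k, c k ∈ integralClosure ℤ_[p] E) ∧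
        γ = ∑ k : Fin n, c k • (δ.map (algebraMap F E)) ^ (k : ℕ)) ∧
      IsKottwitz p σ γ := by
  have htow : IsScalarTower ℤ_[p] F E := IsScalarTower.of_algebraMap_eq fun x => by
    rw [IsScalarTower.algebraMap_apply ℤ_[p] ℚ_[p] E, IsScalarTower.algebraMap_apply ℚ_[p] F E,
      ← IsScalarTower.algebraMap_apply ℤ_[p] ℚ_[p] F]
  obtain ⟨c, a, b, hca, hcb, hbu, ha2, ha⟩ := exists_gen p σ hσ2 hfix hdeg hunr
  have hinj : Function.Injective (algebraMap F E) := (algebraMap F E).injective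
  have hint : ∀ x : F, IsIntegral ℤ_[p] (algebraMap F E x) ↔ IsIntegral ℤ_[p] x := fun x =>
    isIntegral_algebraMap_iff hinj
  set δE := δ.map (algebraMap F E) with hδE
  have hcharE : δE.charpoly = δ.charpoly.map (algebraMap F E) :=
    (Matrix.charpoly_map δ (algebraMap F E))
  obtain ⟨g, hg, hgi, h, hhi, hgh, -⟩ := hconj
  have hdetg : IsUnit g.det := (Matrix.isUnit_iff_isUnit_det g).mp hg
  have hdetint : ∀ m : Matrix (Fin n) (Fin n) E, (∀ i j, m i j ∈ integralClosure ℤ_[p] E) →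
      ∃ m' : Matrix (Fin n) (Fin n) (integralClosure ℤ_[p] E),
        m = m'.map (algebraMap (integralClosure ℤ_[p] E) E) := fun m hm =>
    ⟨Matrix.of fun i j => ⟨m i j, hm i j⟩, by ext i j; rfl⟩
  obtain ⟨k, hk⟩ := hdetint _ hgi
  obtain ⟨h', hh'⟩ := hdetint _ hhi
  have hchar : (g⁻¹ * δE * g).charpoly = δE.charpoly := by
    obtain ⟨u, rfl⟩ := hg
    exact Matrix.charpoly_units_conj' u δE
  have hcoeff : ∀ i, δ.charpoly.coeff i ∈ integralClosure ℤ_[p] F := by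
    intro i
    rw [mem_integralClosure_iff, ← hint, ← Polynomial.coeff_map, ← hcharE, ← hchar, hk,
      Matrix.charpoly_map, Polynomial.coeff_map]
    exact (k.charpoly.coeff i).2
  obtain ⟨f, hfmap, hfdeg, hfm⟩ := Polynomial.lifts_and_natDegree_eq_and_monic
    (f := algebraMap (integralClosure ℤ_[p] F) F) (p := δ.charpoly)
    ((Polynomial.lifts_iff_coeff_lifts _).mpr fun i => ⟨⟨_, hcoeff i⟩, rfl⟩)
    (Matrix.charpoly_monic δ)
  have hdet : (h'.det : E) * algebraMap F E δ.det = 1 := by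
    have h1 : (h'.det : E) = h.det := by
      rw [hh']
      exact (RingHom.map_det (algebraMap (integralClosure ℤ_[p] E) E) h')
    have h2 : algebraMap F E δ.det = (g⁻¹ * δE * g).det := by
      rw [Matrix.det_mul, Matrix.det_mul, mul_right_comm, ← Matrix.det_mul,
        Matrix.nonsing_inv_mul g hdetg, Matrix.det_one, one_mul]
      exact (RingHom.map_det (algebraMap F E) δ)
    rw [h1, h2, mul_comm, ← Matrix.det_mul, hgh, Matrix.det_one]
  have hf0 : IsUnit (f.coeff 0) := by
    have hdinv : IsIntegral ℤ_[p] (δ.det⁻¹) := by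
      rw [← hint, map_inv₀, ← eq_inv_of_mul_eq_one_left hdet]
      exact h'.det.2
    have hd0 : δ.det ≠ 0 := ((Matrix.isUnit_iff_isUnit_det δ).mp hδ).ne_zero
    have hc0 : ((f.coeff 0 : integralClosure ℤ_[p] F) : F) = δ.charpoly.coeff 0 := by
      rw [← hfmap, Polynomial.coeff_map]; rfl
    refine IsUnit.of_mul_eq_one ((-1) ^ n * ⟨δ.det⁻¹, hdinv⟩) ?_
    apply Subtype.ext
    push_cast
    have hs := Matrix.det_eq_sign_charpoly_coeff δ
    rw [Fintype.card_fin] at hs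
    rw [hc0]
    calc δ.charpoly.coeff 0 * ((-1) ^ n * δ.det⁻¹)
        = ((-1) ^ n * δ.charpoly.coeff 0) * δ.det⁻¹ := by ring
      _ = 1 := by rw [← hs, mul_inv_cancel₀ hd0]
  obtain ⟨P, Q, hP, hQ, hdvd⟩ := exists_repr p f hfm hf0 a b hbu ha2 ha
  let ι : integralClosure ℤ_[p] F →+* E :=
    (algebraMap F E).comp (algebraMap (integralClosure ℤ_[p] F) F)
  have hιint : ∀ x, ι x ∈ integralClosure ℤ_[p] E := fun x => (hint _).mpr x.2
  have hσι : ∀ x, σ (ι x) = ι x := fun x => σ.commutes _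
  have hfE : Polynomial.aeval δE (f.map ι) = 0 := by
    rw [← Polynomial.map_map, hfmap, ← hcharE]
    exact Matrix.aeval_self_charpoly δE
  have hfd : f.degree = n := by
    rw [Polynomial.degree_eq_natDegree hfm.ne_zero, hfdeg, Matrix.charpoly_natDegree_eq_dim,
      Fintype.card_fin]
  set PE := P.map ι with hPE
  set QE := Q.map ι with hQE
  have hrel : Polynomial.aeval δE (PE ^ 2 + Polynomial.C (ι a) * PE * QE
      + Polynomial.C (ι b) * QE ^ 2) = δE := by
    obtain ⟨q, hq⟩ := hdvd
    have h1 := congrArg (fun r => Polynomial.aeval δE (Polynomial.map ι r)) hq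
    simp only [Polynomial.map_sub, Polynomial.map_add, Polynomial.map_mul, Polynomial.map_pow,
      Polynomial.map_C, Polynomial.map_X] at h1
    rw [map_sub, map_mul, hfE, zero_mul, Polynomial.aeval_X] at h1
    exact sub_eq_zero.mp h1
  let γP : Polynomial E := PE + Polynomial.C (c : E) * QE
  have hmapσ : ∀ r : Polynomial E, (Polynomial.aeval δE r).map σ
      = Polynomial.aeval δE (r.map (σ : E →+* E)) := by
    intro r
    have hδσ : δE.map σ = δE := by
      ext i j
      simp [hδE]
    have h1 : (Polynomial.aeval δE r).map σ = (σ : E →+* E).mapMatrix (Polynomial.aeval δE r) := rfl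
    rw [h1]
    induction r using Polynomial.induction_on' with
    | add r s hr hs => simp only [map_add, Polynomial.map_add]; rw [hr rfl, hs rfl]
    | monomial m e =>
      rw [Polynomial.map_monomial, Polynomial.aeval_monomial, Polynomial.aeval_monomial, map_mul,
        map_pow]
      congr 1
      · ext i j
        simp [Matrix.algebraMap_matrix_apply, apply_ite σ]
      · exact congrArg (· ^ m) hδσ
  have hγσ : γP.map (σ : E →+* E) = PE + Polynomial.C (σ c) * QE := by
    have : ∀ r : Polynomial (integralClosure ℤ_[p] F), (r.map ι).map (σ : E →+* E) = r.map ι := by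
      intro r
      rw [Polynomial.map_map]
      congr 1
      ext x
      exact hσι x
    simp only [γP, Polynomial.map_add, Polynomial.map_mul, Polynomial.map_C]
    rw [hPE, hQE, this, this]
    rfl
  have hprod : ((Polynomial.aeval δE γP).map σ) * Polynomial.aeval δE γP = δE := by
    rw [hmapσ, hγσ, ← map_mul]
    conv_rhs => rw [← hrel]
    congr 1
    have h1 : ι a = c + σ c := hca.symm
    have h2 : ι b = c * σ c := hcb.symm
    rw [h1, h2]
    simp only [γP, Polynomial.C_add, Polynomial.C_mul]
    ring
  have hγdeg : γP.natDegree < n := by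
    have h1 : γP.degree < n := by
      refine lt_of_le_of_lt (Polynomial.degree_add_le _ _) (max_lt ?_ ?_)
      · exact lt_of_le_of_lt Polynomial.degree_map_le (hfd ▸ hP)
      · rw [← Polynomial.smul_eq_C_mul]
        exact lt_of_le_of_lt (Polynomial.degree_smul_le _ _)
          (lt_of_le_of_lt Polynomial.degree_map_le (hfd ▸ hQ))
    by_cases h0 : γP = 0
    · rw [h0, Polynomial.natDegree_zero]; omega
    · exact (Polynomial.natDegree_lt_iff_degree_lt h0).mpr h1
  have hsum : ∃ c : Fin n → E, (∀ k, c k ∈ integralClosure ℤ_[p] E) ∧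
      Polynomial.aeval δE γP = ∑ k : Fin n, c k • δE ^ (k : ℕ) := by
    refine ⟨fun k => γP.coeff k, fun k => ?_, ?_⟩
    · simp only [γP, Polynomial.coeff_add, Polynomial.coeff_C_mul, hPE, hQE, Polynomial.coeff_map]
      exact add_mem (hιint _) (mul_mem c.2 (hιint _))
    · rw [Polynomial.aeval_eq_sum_range' hγdeg, Finset.sum_range]
  refine ⟨Polynomial.aeval δE γP, ?_, hprod, hsum, Or.inl ?_⟩
  · rw [Matrix.isUnit_iff_isUnit_det]
    have h1 := congrArg Matrix.det hprod
    rw [Matrix.det_mul] at h1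
    have h2 : IsUnit δE.det := by
      have : δE.det = algebraMap F E δ.det := (RingHom.map_det (algebraMap F E) δ).symm
      rw [this]
      exact ((Matrix.isUnit_iff_isUnit_det δ).mp hδ).map _
    rw [← h1] at h2
    exact isUnit_of_mul_isUnit_right h2
  · rw [hprod]
    exact hsum
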